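/- Define f : ℝ → ℝ by f(x) = 1 if x ∈ (−∞, −3] ∪ [1, +∞), f(x) = |x + 2| if x ∈ (−3, −1), and f(x) = √|x| if x ∈ [−1, 1]. Then there is no error bifunction e : ℝ × ℝ → ℝ ∪ {+∞} with ℝ × ℝ ⊆ dom e for which f is e-quasiconvex. -/

import Mathlib

/- Setting: real-valued functions on ℝ. Since the error bifunctions considered
here satisfy `ℝ × ℝ ⊆ dom e`, they are modeled as real-valued maps
`e : ℝ → ℝ → ℝ` that are nonnegative and symmetric. -/

noncomputable section

/-- `e` is a (finite-valued) error bifunction: nonnegative and symmetric. -/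
def IsErrorBifunR (e : ℝ → ℝ → ℝ) : Prop :=
  (∀ x y, 0 ≤ e x y) ∧ (∀ x y, e x y = e y x)

/-- `f : ℝ → ℝ` is `e`-convex. -/
def EConvexR (e : ℝ → ℝ → ℝ) (f : ℝ → ℝ) : Prop :=
  ∀ x y : ℝ, ∀ t ∈ Set.Ioo (0:ℝ) 1,
    f (t * x + (1 - t) * y) ≤ t * f x + (1 - t) * f y + t * (1 - t) * e x y

/-- `f : ℝ → ℝ` is `e`-quasiconvex. -/
def EQuasiconvexR (e : ℝ → ℝ → ℝ) (f : ℝ → ℝ) : Prop :=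
  ∀ x y : ℝ, ∀ t ∈ Set.Ioo (0:ℝ) 1,
    f (t * x + (1 - t) * y) ≤ max (f x) (f y) + t * (1 - t) * e x y

open Classical in
/-- The piecewise function of STATEMENT 18: `f(x) = 1` on `(−∞,−3] ∪ [1,+∞)`,
`f(x) = |x+2|` on `(−3,−1)` and `f(x) = √|x|` on `[−1,1]`. -/
noncomputable def f18 : ℝ → ℝ := fun x =>
  if x ≤ -3 ∨ 1 ≤ x then 1
  else if x < -1 then |x + 2|
  else Real.sqrt |x|

theorem f18_neg_two : f18 (-2) = 0 := by
  norm_num [f18]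

theorem f18_of_mem_Ico {x : ℝ} (hx : x ∈ Set.Ico (-1 : ℝ) 1) : f18 x = Real.sqrt |x| := by
  have h : ¬ (x ≤ -3 ∨ 1 ≤ x) := by
    rintro (h | h) <;> linarith [hx.1, hx.2]
  simp [f18, if_neg h, not_lt.mpr hx.1]

/-- `f18` is not `e`-quasiconvex for any error bifunction `e` with
`ℝ × ℝ ⊆ dom e`. -/
theorem stmt18 :
    ¬ ∃ e : ℝ → ℝ → ℝ, IsErrorBifunR e ∧ EQuasiconvexR e f18 := by
  rintro ⟨e, ⟨he, -⟩, hf⟩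
  set C := e (-2) 0
  have hC : 0 ≤ C := he _ _
  set t : ℝ := 1 / (C ^ 2 + 2) with ht
  have hpos : 0 < C ^ 2 + 2 := by positivity
  have ht0 : 0 < t := by positivity
  have htC : t * (C ^ 2 + 2) = 1 := by rw [ht]; field_simp
  have ht2 : t ≤ 1 / 2 := by nlinarith [mul_nonneg ht0.le (sq_nonneg C)]
  have h := hf (-2) 0 t ⟨ht0, by linarith⟩
  rw [f18_neg_two, f18_of_mem_Ico (x := 0) (by norm_num),
    f18_of_mem_Ico ⟨by linarith, by linarith⟩] at h
  have habs : |t * -2 + (1 - t) * 0| = 2 * t := by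
    rw [abs_of_nonpos (by linarith)]; ring
  rw [habs, abs_zero, Real.sqrt_zero, max_self, zero_add] at h
  have h' : Real.sqrt (2 * t) ≤ t * C :=
    h.trans (by nlinarith [mul_nonneg (mul_nonneg ht0.le ht0.le) hC])
  have hsq : 2 * t ≤ (t * C) ^ 2 := (Real.sqrt_le_left (by positivity)).mp h'
  nlinarith
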